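/- A product ∏_{j∈J} X_j of nonempty topological spaces is sequentially compact if and only if for every subset K ⊆ J of cardinality at most the splitting number 𝔰, the subproduct ∏_{j∈K} X_j is sequentially compact. -/

import Mathlib

universe u

/-- The splitting number `𝔰`: the least cardinality of a family `S` of infinite subsets
of `ℕ` such that every infinite `A ⊆ ℕ` is split by some member of `S`. -/
noncomputable def splittingNumber : Cardinal.{0} :=
  sInf {c : Cardinal.{0} | ∃ S : Set (Set ℕ), Cardinal.mk S = c ∧
    (∀ s ∈ S, s.Infinite) ∧
    ∀ A : Set ℕ, A.Infinite → ∃ s ∈ S, (A ∩ s).Infinite ∧ (A \ s).Infinite}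

open Filter Topology

theorem splittingNumber_exists_family :
    ∃ S : Set (Set ℕ), Cardinal.mk S = splittingNumber ∧
      (∀ s ∈ S, s.Infinite) ∧
      ∀ A : Set ℕ, A.Infinite → ∃ s ∈ S, (A ∩ s).Infinite ∧ (A \ s).Infinite := by
  refine csInf_mem (s := {c : Cardinal.{0} | ∃ S : Set (Set ℕ), Cardinal.mk S = c ∧
    (∀ s ∈ S, s.Infinite) ∧
    ∀ A : Set ℕ, A.Infinite → ∃ s ∈ S, (A ∩ s).Infinite ∧ (A \ s).Infinite})
    ⟨_, {s | s.Infinite}, rfl, fun _ hs => hs, fun A hA => ?_⟩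
  let f := Nat.nth (· ∈ A)
  have hf : StrictMono f := Nat.nth_strictMono hA
  have hfA : ∀ n, f n ∈ A := Nat.nth_mem_of_infinite hA
  have heven : (Set.range fun n => f (2 * n)).Infinite :=
    Set.infinite_range_of_injective fun a b h => by have := hf.injective h; omega
  refine ⟨Set.range fun n => f (2 * n), heven, heven.mono ?_,
    (Set.infinite_range_of_injective (f := fun n => f (2 * n + 1)) fun a b h => by
      have := hf.injective h; omega).mono ?_⟩
  · rintro _ ⟨n, rfl⟩
    exact ⟨hfA _, n, rfl⟩
  · rintro _ ⟨n, rfl⟩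
    refine ⟨hfA _, ?_⟩
    rintro ⟨m, hm⟩
    have := hf.injective hm
    omega

theorem SeqCompactSpace.of_surjective {X Y : Type*} [TopologicalSpace X] [TopologicalSpace Y]
    [SeqCompactSpace X] {f : X → Y} (hf : Continuous f) (hsurj : Function.Surjective f) :
    SeqCompactSpace Y := by
  refine ⟨fun y _ => ?_⟩
  choose x hx using fun n => hsurj (y n)
  obtain ⟨a, φ, hφ, ha⟩ := SeqCompactSpace.tendsto_subseq x
  refine ⟨f a, Set.mem_univ _, φ, hφ, ?_⟩
  simpa [Function.comp_def, hx] using (hf.tendsto a).comp ha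

/-- In a sequentially compact space where any two points specialize to a common point,
every sequence converges. -/
theorem SeqCompactSpace.exists_tendsto_of_specializes {X : Type*} [TopologicalSpace X]
    [SeqCompactSpace X] (h : ∀ p q : X, ∃ z, p ⤳ z ∧ q ⤳ z) (x : ℕ → X) :
    ∃ a, Tendsto x atTop (𝓝 a) := by
  choose m hl hr using h
  let z : ℕ → X := fun n => Nat.rec (x 0) (fun k w => m w (x (k + 1))) n
  have hz : ∀ i n, i ≤ n → z i ⤳ z n := fun i n hin => by
    induction n, hin using Nat.le_induction with
    | base => exact specializes_rfl
    | succ n _ ih => exact ih.trans (hl _ _)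
  have hxz : ∀ i, x i ⤳ z i
    | 0 => specializes_rfl
    | _ + 1 => hr _ _
  obtain ⟨a, φ, hφ, ha⟩ := SeqCompactSpace.tendsto_subseq z
  refine ⟨a, tendsto_nhds.2 fun U hU haU => Eventually.of_forall fun i => ?_⟩
  obtain ⟨k, hkU, hk⟩ :=
    ((ha.eventually (hU.mem_nhds haU)).and (eventually_ge_atTop i)).exists
  exact ((hxz i).trans (hz i _ (hk.trans hφ.le_apply))).mem_open hU hkU

/-- A product indexed by a splitting family is not sequentially compact if each factor
has two points that do not specialize to a common point. -/
theorem not_seqCompactSpace_pi_of_splitting {ι : Type*} {X : ι → Type*}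
    [∀ i, TopologicalSpace (X i)] (s : ι → Set ℕ)
    (hs : ∀ A : Set ℕ, A.Infinite → ∃ i, (A ∩ s i).Infinite ∧ (A \ s i).Infinite)
    (h : ∀ i, ∃ p q : X i, ∀ z, p ⤳ z → ¬ q ⤳ z) : ¬ SeqCompactSpace (Π i, X i) := by
  classical
  intro _
  choose p q hpq using h
  obtain ⟨a, φ, hφ, ha⟩ :=
    SeqCompactSpace.tendsto_subseq fun n i => if n ∈ s i then p i else q i
  obtain ⟨i, hin, hout⟩ := hs (Set.range φ) (Set.infinite_range_of_injective hφ.injective)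
  have hai := tendsto_pi_nhds.1 ha i
  have key : ∀ B : Set ℕ, (Set.range φ ∩ B).Infinite → ∃ᶠ n in atTop, φ n ∈ B := by
    intro B hB
    rw [Nat.frequently_atTop_iff_infinite]
    refine Set.Infinite.of_image φ (hB.mono ?_)
    rintro _ ⟨⟨n, rfl⟩, hn⟩
    exact ⟨n, hn, rfl⟩
  refine hpq i (a i) (specializes_iff_forall_open.2 fun U hU haU => ?_)
    (specializes_iff_forall_open.2 fun U hU haU => ?_)
  · obtain ⟨n, hn, hnU⟩ := ((key _ hin).and_eventually (hai.eventually_mem (hU.mem_nhds haU))).exists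
    simpa only [Function.comp_apply, if_pos hn] using hnU
  · obtain ⟨n, hn, hnU⟩ :=
      ((key (s i)ᶜ hout).and_eventually (hai.eventually_mem (hU.mem_nhds haU))).exists
    simpa only [Function.comp_apply, if_neg hn] using hnU

/-- A product of nonempty topological spaces is sequentially compact iff so is every
subproduct with at most `𝔰` factors. -/
theorem seqCompact_pi_iff_subproducts {J : Type u} (X : J → Type u)
    [∀ j, TopologicalSpace (X j)] [∀ j, Nonempty (X j)] :
    SeqCompactSpace (Π j, X j) ↔
      ∀ K : Set J, Cardinal.mk K ≤ Cardinal.lift.{u} splittingNumber →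
        SeqCompactSpace (Π j : K, X j) := by
  refine ⟨fun _ K _ => .of_surjective (Pi.continuous_domRestrict K)
    (Subtype.surjective_restrict _), fun h => ?_⟩
  let N : Set J := {j | ∃ x : ℕ → X j, ∀ a, ¬ Tendsto x atTop (𝓝 a)}
  rcases le_total (Cardinal.mk N) (Cardinal.lift.{u} splittingNumber) with hN | hN
  · have := h N hN
    refine ⟨fun x _ => ?_⟩
    obtain ⟨a, φ, hφ, ha⟩ := SeqCompactSpace.tendsto_subseq fun n (j : N) => x n j
    have hlim : ∀ j, ∃ b, Tendsto (fun n => x (φ n) j) atTop (𝓝 b) := fun j => by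
      by_cases hj : j ∈ N
      · exact ⟨a ⟨j, hj⟩, tendsto_pi_nhds.1 ha ⟨j, hj⟩⟩
      · by_contra! hb
        exact hj ⟨_, hb⟩
    choose b hb using hlim
    exact ⟨b, Set.mem_univ _, φ, hφ, tendsto_pi_nhds.2 hb⟩
  · obtain ⟨K, hKN, hK⟩ := Cardinal.le_mk_iff_exists_subset.1 hN
    have hcompact := h K hK.le
    obtain ⟨S, hS, -, hsplit⟩ := splittingNumber_exists_family
    obtain ⟨e⟩ : Nonempty (K ≃ S) := by
      rw [← Cardinal.lift_mk_eq', hK, hS]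
      simp
    refine absurd hcompact (not_seqCompactSpace_pi_of_splitting (fun k => (e k : Set ℕ))
      (fun A hA => ?_) fun k => ?_)
    · obtain ⟨s, hs, hAs⟩ := hsplit A hA
      exact ⟨e.symm ⟨s, hs⟩, by simpa using hAs⟩
    · have : SeqCompactSpace (X k) := .of_surjective (continuous_apply k)
        (Function.surjective_eval (β := fun k : K => X k) k)
      obtain ⟨x, hx⟩ := hKN k.2
      by_contra! hpq
      obtain ⟨a, ha⟩ := SeqCompactSpace.exists_tendsto_of_specializes hpq x
      exact hx a ha
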